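/- Let γ ≥ 0. Then inf σ(H₀ − γT₁) = −γ; moreover −γ lies in the essential spectrum of H₀ − γT₁, so E_min(H₀ − γT₁) = −γ. -/

import Mathlib

open MeasureTheory Filter Topology Metric

noncomputable section

namespace EfimovExample

/-- `pₙ = 1 - 2⁻ⁿ` (so `p₀ = 0`, `p₁ = 1/2`, ...). -/
def p (n : ℕ) : ℝ := 1 - (1 / 2 : ℝ) ^ n

/-- `qₙ = (p_{n-1} + pₙ)/2`, the midpoint of `[p_{n-1}, pₙ]`. -/
def q (n : ℕ) : ℝ := (p (n - 1) + p n) / 2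

/-- `ξₙ(y) = π (y - p_{n-1})/(pₙ - p_{n-1})` on `[p_{n-1}, pₙ]` and `0` elsewhere. -/
def ξ (n : ℕ) (y : ℝ) : ℝ :=
  if y ∈ Set.Icc (p (n - 1)) (p n) then
    Real.pi * (y - p (n - 1)) / (p n - p (n - 1))
  else 0

/-- `φₙ(y) = 2^{(n+1)/2} sin (ξₙ(y))`. -/
def φ (n : ℕ) (y : ℝ) : ℝ := 2 ^ ((n + 1 : ℝ) / 2) * Real.sin (ξ n y)

/-- The kernel `k₂(y,t) = Σ_{n ≥ 1} (2/3)ⁿ φₙ(y) φₙ(t)`. -/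
def k₂ (y t : ℝ) : ℝ := ∑' n : ℕ, (2 / 3 : ℝ) ^ (n + 1) * φ (n + 1) y * φ (n + 1) t

/-- The tent function `rₙ`, supported on `[p_{n-1}, pₙ]` with peak `1` at `qₙ`. -/
def r (n : ℕ) (x : ℝ) : ℝ :=
  if x ∈ Set.Icc (p (n - 1)) (q n) then (x - p (n - 1)) / (q n - p (n - 1))
  else if x ∈ Set.Icc (q n) (p n) then (p n - x) / (p n - q n)
  else 0

/-- `u(x) = 0` on `[0, 1/2]`, and `u(x) = Σ_{n ≥ 1} δₙ rₙ(x)` for `x > 1/2`. -/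
def u (δ : ℕ → ℝ) (x : ℝ) : ℝ :=
  if x ≤ 1 / 2 then 0 else ∑' n : ℕ, δ (n + 1) * r (n + 1) x

/-- Lebesgue measure on `[0,1]`. -/
def μI : Measure ℝ := volume.restrict (Set.Icc 0 1)

/-- Lebesgue measure on `[0,1]²`. -/
def μI2 : Measure (ℝ × ℝ) := μI.prod μI

variable {𝓗 : Type*} [NormedAddCommGroup 𝓗] [InnerProductSpace ℂ 𝓗]

/-- `z` is an isolated point of the set `S`. -/
def IsIsolatedIn (S : Set ℂ) (z : ℂ) : Prop :=
  z ∈ S ∧ ∃ ε > 0, S ∩ Metric.ball z ε = {z}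

/-- Discrete spectrum: the set of isolated points of the spectrum that are eigenvalues of
finite multiplicity. -/
def discreteSpectrum (A : 𝓗 →L[ℂ] 𝓗) : Set ℂ :=
  {z | IsIsolatedIn (spectrum ℂ A) z ∧
    Module.End.HasEigenvalue (A : 𝓗 →ₗ[ℂ] 𝓗) z ∧
    FiniteDimensional ℂ (Module.End.eigenspace (A : 𝓗 →ₗ[ℂ] 𝓗) z)}

/-- Essential spectrum: spectrum minus discrete spectrum. -/
def essSpectrum (A : 𝓗 →L[ℂ] 𝓗) : Set ℂ :=
  spectrum ℂ A \ discreteSpectrum A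

/-- Bottom of the essential spectrum (as a real number). -/
def Emin (A : 𝓗 →L[ℂ] 𝓗) : ℝ :=
  sInf {x : ℝ | (x : ℂ) ∈ essSpectrum A}

/-- The span of all eigenspaces with (real) eigenvalue strictly below `E`. -/
def eigBelow (A : 𝓗 →L[ℂ] 𝓗) (E : ℝ) : Submodule ℂ 𝓗 :=
  ⨆ t : {t : ℝ // t < E}, Module.End.eigenspace (A : 𝓗 →ₗ[ℂ] 𝓗) ((t : ℝ) : ℂ)

instance : IsProbabilityMeasure μI := ⟨by simp [μI]⟩

instance : IsProbabilityMeasure μI2 := by unfold μI2; infer_instance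

lemma p_mono {m n : ℕ} (h : m ≤ n) : p m ≤ p n := by
  unfold p
  have := pow_le_pow_of_le_one (a := (1 / 2 : ℝ)) (by norm_num) (by norm_num) h
  linarith

lemma r_nonneg (n : ℕ) (x : ℝ) : 0 ≤ r n x := by
  have h := p_mono (Nat.sub_le n 1)
  have h1 : p (n - 1) ≤ q n := by unfold q; linarith
  have h2 : q n ≤ p n := by unfold q; linarith
  unfold r
  split_ifs with ha hb
  · exact div_nonneg (by linarith [ha.1]) (by linarith)
  · exact div_nonneg (by linarith [hb.2]) (by linarith)
  · exact le_rfl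

lemma u_nonneg (δ : ℕ → ℝ) (hδ₁ : δ 1 = 1)
    (hδ : ∀ n : ℕ, 2 ≤ n → 0 ≤ δ n ∧ δ n ≤ (Real.sqrt 2 / 3) ^ n) (x : ℝ) : 0 ≤ u δ x := by
  unfold u
  split_ifs
  · exact le_rfl
  · refine tsum_nonneg fun n => mul_nonneg ?_ (r_nonneg _ _)
    rcases n with _ | n
    · simp [hδ₁]
    · exact (hδ (n + 1 + 1) (by omega)).1

lemma re_inner_H₀_nonneg (δ : ℕ → ℝ) (hu : ∀ x, 0 ≤ u δ x)
    (H₀ : Lp ℂ 2 μI2 →L[ℂ] Lp ℂ 2 μI2)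
    (hH₀ : ∀ f : Lp ℂ 2 μI2,
      (H₀ f : ℝ × ℝ → ℂ) =ᵐ[μI2] fun xy => ((u δ xy.1 * u δ xy.2 : ℝ) : ℂ) * f xy)
    (f : Lp ℂ 2 μI2) : 0 ≤ (inner ℂ (H₀ f) f).re := by
  have : inner ℂ (H₀ f) f
      = ((∫ a, u δ a.1 * u δ a.2 * ‖f a‖ ^ 2 ∂μI2 : ℝ) : ℂ) := by
    rw [L2.inner_def, ← integral_complex_ofReal]
    refine integral_congr_ae ?_
    filter_upwards [hH₀ f] with a ha
    rw [ha]
    simp only [RCLike.inner_apply, map_mul, Complex.conj_ofReal]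
    push_cast
    rw [← Complex.mul_conj']
    ring
  rw [this, Complex.ofReal_re]
  exact integral_nonneg fun a => mul_nonneg (mul_nonneg (hu _) (hu _)) (by positivity)

lemma lintegral_μI2 (g : ℝ × ℝ → ENNReal) (hg : Measurable g) :
    ∫⁻ z, g z ∂μI2 = ∫⁻ y, (∫⁻ s, g (s, y) ∂μI) ∂μI := by
  rw [μI2, lintegral_prod_symm _ hg.aemeasurable]

lemma lintegral_snd_μI2 (g : ℝ → ENNReal) (hg : Measurable g) :
    ∫⁻ z, g z.2 ∂μI2 = ∫⁻ y, g y ∂μI := by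
  rw [lintegral_μI2 (fun z => g z.2) (hg.comp measurable_snd)]
  simp

lemma norm_T₁_le (T₁ : Lp ℂ 2 μI2 →L[ℂ] Lp ℂ 2 μI2)
    (hT₁ : ∀ f : Lp ℂ 2 μI2,
      (T₁ f : ℝ × ℝ → ℂ) =ᵐ[μI2] fun xy => ∫ s, f (s, xy.2) ∂μI)
    (f : Lp ℂ 2 μI2) : ‖T₁ f‖ ≤ ‖f‖ := by
  have hf : Measurable fun z => ‖f z‖ₑ ^ (2 : ℝ) :=
    ((Lp.stronglyMeasurable f).measurable.enorm).pow_const _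
  have key : ∀ y, ‖∫ s, f (s, y) ∂μI‖ₑ ^ (2 : ℝ) ≤ ∫⁻ s, ‖f (s, y)‖ₑ ^ (2 : ℝ) ∂μI := by
    intro y
    have hm : AEStronglyMeasurable (fun s => f (s, y)) μI :=
      ((Lp.stronglyMeasurable f).comp_measurable measurable_prodMk_right).aestronglyMeasurable
    have h1 := eLpNorm_le_eLpNorm_of_exponent_le (p := 1) (q := 2) (by norm_num) hm
    rw [eLpNorm_one_eq_lintegral_enorm,
      eLpNorm_eq_lintegral_rpow_enorm_toReal two_ne_zero ENNReal.ofNat_ne_top] at h1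
    have h2 := (enorm_integral_le_lintegral_enorm (μ := μI) (fun s => f (s, y))).trans h1
    have h3 := ENNReal.rpow_le_rpow h2 (z := 2) (by norm_num)
    rw [← ENNReal.rpow_mul] at h3
    simpa using h3
  rw [Lp.norm_def, Lp.norm_def]
  refine ENNReal.toReal_mono (Lp.eLpNorm_ne_top f) ?_
  rw [eLpNorm_congr_ae (hT₁ f),
    eLpNorm_eq_lintegral_rpow_enorm_toReal two_ne_zero ENNReal.ofNat_ne_top,
    eLpNorm_eq_lintegral_rpow_enorm_toReal two_ne_zero ENNReal.ofNat_ne_top]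
  refine ENNReal.rpow_le_rpow ?_ (by norm_num)
  simp only [ENNReal.toReal_ofNat]
  calc ∫⁻ z, ‖∫ s, f (s, z.2) ∂μI‖ₑ ^ (2 : ℝ) ∂μI2
      ≤ ∫⁻ z, (∫⁻ s, ‖f (s, z.2)‖ₑ ^ (2 : ℝ) ∂μI) ∂μI2 := lintegral_mono fun z => key z.2
    _ = ∫⁻ y, (∫⁻ s, ‖f (s, y)‖ₑ ^ (2 : ℝ) ∂μI) ∂μI := by
        have hg : Measurable fun y => ∫⁻ s, ‖f (s, y)‖ₑ ^ (2 : ℝ) ∂μI := hf.lintegral_prod_left'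
        exact lintegral_snd_μI2 _ hg
    _ = ∫⁻ z, ‖f z‖ₑ ^ (2 : ℝ) ∂μI2 := by
        exact (lintegral_μI2 _ hf).symm

/-- The disjoint horizontal strips used to build eigenfunctions. -/
def strip (n : ℕ) : Set (ℝ × ℝ) :=
  Set.univ ×ˢ Set.Ioo (1 / ((n : ℝ) + 3)) (1 / ((n : ℝ) + 2))

lemma strip_meas (n : ℕ) : MeasurableSet (strip n) := MeasurableSet.univ.prod measurableSet_Ioo

lemma strip_disj {m n : ℕ} (h : m < n) : strip m ∩ strip n = ∅ := by
  ext z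
  simp only [strip, Set.mem_inter_iff, Set.mem_prod, Set.mem_univ, true_and, Set.mem_Ioo,
    Set.mem_empty_iff_false, iff_false]
  rintro ⟨⟨h1, -⟩, ⟨-, h2⟩⟩
  have h3 : (m : ℝ) + 3 ≤ n + 2 := by
    have : ((m + 1 : ℕ) : ℝ) ≤ n := by exact_mod_cast h
    push_cast at this; linarith
  have := one_div_le_one_div_of_le (by positivity) h3
  linarith

lemma strip_le {n : ℕ} {z : ℝ × ℝ} (h : z ∈ strip n) : z.2 ≤ 1 / 2 := by
  have h2 := h.2.2
  have : 1 / ((n : ℝ) + 2) ≤ 1 / 2 :=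
    one_div_le_one_div_of_le (by norm_num) (by linarith [(Nat.cast_nonneg n : (0 : ℝ) ≤ n)])
  linarith

lemma strip_pos (n : ℕ) : μI2 (strip n) ≠ 0 := by
  have h0 : (0 : ℝ) ≤ n := Nat.cast_nonneg n
  have h1 : 1 / ((n : ℝ) + 2) ≤ 1 / 2 := one_div_le_one_div_of_le (by norm_num) (by linarith)
  have h2 : 1 / ((n : ℝ) + 3) < 1 / ((n : ℝ) + 2) :=
    one_div_lt_one_div_of_lt (by linarith) (by linarith)
  have h3 : 0 < 1 / ((n : ℝ) + 3) := by positivity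
  have hsub : Set.Ioo (1 / ((n : ℝ) + 3)) (1 / ((n : ℝ) + 2)) ⊆ Set.Icc 0 1 :=
    fun y hy => ⟨by linarith [hy.1], by linarith [hy.2]⟩
  rw [μI2, strip, Measure.prod_prod, measure_univ, one_mul, μI, Measure.restrict_apply measurableSet_Ioo,
    Set.inter_eq_left.2 hsub, Real.volume_Ioo]
  simpa using h2

/-- The eigenfunctions. -/
def ev (n : ℕ) : Lp ℂ 2 μI2 := indicatorConstLp 2 (strip_meas n) (measure_ne_top μI2 _) (1 : ℂ)

lemma ev_ne_zero (n : ℕ) : ev n ≠ 0 := by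
  rw [← norm_ne_zero_iff, ev, norm_indicatorConstLp two_ne_zero ENNReal.ofNat_ne_top]
  have : 0 < μI2.real (strip n) :=
    ENNReal.toReal_pos (strip_pos n) (measure_ne_top _ _)
  simp only [norm_one, one_mul]
  positivity

lemma ev_indep : LinearIndependent ℂ ev := by
  refine linearIndependent_of_ne_zero_of_inner_eq_zero ev_ne_zero ?_
  intro m n hmn
  have : strip m ∩ strip n = ∅ := by
    rcases lt_or_gt_of_ne hmn with h | h
    · exact strip_disj h
    · rw [Set.inter_comm]; exact strip_disj h
  simp only [ev]
  rw [L2.inner_indicatorConstLp_indicatorConstLp, this]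
  simp

lemma H₀_ev (δ : ℕ → ℝ) (H₀ : Lp ℂ 2 μI2 →L[ℂ] Lp ℂ 2 μI2)
    (hH₀ : ∀ f : Lp ℂ 2 μI2,
      (H₀ f : ℝ × ℝ → ℂ) =ᵐ[μI2] fun xy => ((u δ xy.1 * u δ xy.2 : ℝ) : ℂ) * f xy)
    (n : ℕ) : H₀ (ev n) = 0 := by
  refine Lp.ext ?_
  have h1 : (ev n : ℝ × ℝ → ℂ) =ᵐ[μI2] (strip n).indicator fun _ => 1 := indicatorConstLp_coeFn
  filter_upwards [hH₀ (ev n), h1, Lp.coeFn_zero ℂ 2 μI2] with z hz h1 h0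
  rw [hz, h1, h0]
  by_cases h : z ∈ strip n
  · have : u δ z.2 = 0 := by simp only [u]; rw [if_pos (strip_le h)]
    simp [this]
  · simp [h]

lemma T₁_ev (T₁ : Lp ℂ 2 μI2 →L[ℂ] Lp ℂ 2 μI2)
    (hT₁ : ∀ f : Lp ℂ 2 μI2,
      (T₁ f : ℝ × ℝ → ℂ) =ᵐ[μI2] fun xy => ∫ s, f (s, xy.2) ∂μI)
    (n : ℕ) : T₁ (ev n) = ev n := by
  refine Lp.ext ?_
  have h1 : (ev n : ℝ × ℝ → ℂ) =ᵐ[μI2] (strip n).indicator fun _ => 1 := indicatorConstLp_coeFn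
  have h2 : ∀ᵐ y ∂μI, ∀ᵐ s ∂μI, ev n (s, y) = (strip n).indicator (fun _ => (1 : ℂ)) (s, y) := by
    have := (Measure.measurePreserving_swap (μ := μI) (ν := μI)).quasiMeasurePreserving.ae h1
    exact Measure.ae_ae_of_ae_prod this
  have h3 : ∀ᵐ z ∂μI2, ∀ᵐ s ∂μI,
      ev n (s, z.2) = (strip n).indicator (fun _ => (1 : ℂ)) (s, z.2) :=
    (Measure.quasiMeasurePreserving_snd (μ := μI) (ν := μI)).ae h2
  filter_upwards [hT₁ (ev n), h1, h3] with z hz h1 h3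
  rw [hz, h1, integral_congr_ae h3]
  have : ∀ s, (strip n).indicator (fun _ => (1 : ℂ)) (s, z.2)
      = (strip n).indicator (fun _ => (1 : ℂ)) z := by
    intro s
    simp [Set.indicator, strip]
  simp [this]

/-- For `γ ≥ 0`, `inf σ(H₀ - γT₁) = -γ`; moreover `-γ` lies in the essential spectrum of
`H₀ - γT₁`, hence `E_min(H₀ - γT₁) = -γ`. -/
theorem inf_spectrum_H₀_sub_γT₁
    (δ : ℕ → ℝ) (hδ₁ : δ 1 = 1)
    (hδ : ∀ n : ℕ, 2 ≤ n → 0 ≤ δ n ∧ δ n ≤ (Real.sqrt 2 / 3) ^ n)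
    (H₀ : Lp ℂ 2 μI2 →L[ℂ] Lp ℂ 2 μI2)
    (hH₀ : ∀ f : Lp ℂ 2 μI2,
      (H₀ f : ℝ × ℝ → ℂ) =ᵐ[μI2] fun xy => ((u δ xy.1 * u δ xy.2 : ℝ) : ℂ) * f xy)
    (T₁ : Lp ℂ 2 μI2 →L[ℂ] Lp ℂ 2 μI2)
    (hT₁ : ∀ f : Lp ℂ 2 μI2,
      (T₁ f : ℝ × ℝ → ℂ) =ᵐ[μI2] fun xy => ∫ s, f (s, xy.2) ∂μI)
    (γ : ℝ) (hγ : 0 ≤ γ) :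
    sInf {x : ℝ | (x : ℂ) ∈ spectrum ℂ (H₀ - (γ : ℂ) • T₁)} = -γ ∧
    ((-γ : ℝ) : ℂ) ∈ essSpectrum (H₀ - (γ : ℂ) • T₁) ∧
    Emin (H₀ - (γ : ℂ) • T₁) = -γ := by
  set A := H₀ - (γ : ℂ) • T₁ with hA
  have hev : ∀ n, A (ev n) = ((-γ : ℝ) : ℂ) • ev n := by
    intro n
    rw [hA, sub_apply, smul_apply, H₀_ev δ H₀ hH₀ n, T₁_ev T₁ hT₁ n]
    simp
  have hspec : ((-γ : ℝ) : ℂ) ∈ spectrum ℂ A := by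
    rw [spectrum.mem_iff]
    intro hunit
    rw [ContinuousLinearMap.isUnit_iff_bijective] at hunit
    refine ev_ne_zero 0 (hunit.1 ?_)
    rw [map_zero, sub_apply, hev, Algebra.algebraMap_eq_smul_one, smul_apply]
    exact sub_self _
  have hess : ((-γ : ℝ) : ℂ) ∈ essSpectrum A := by
    refine ⟨hspec, ?_⟩
    rintro ⟨-, -, hfin⟩
    let w : ℕ → Module.End.eigenspace (A : Lp ℂ 2 μI2 →ₗ[ℂ] Lp ℂ 2 μI2) ((-γ : ℝ) : ℂ) :=
      fun n => ⟨ev n, Module.End.mem_eigenspace_iff.2 (hev n)⟩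
    have hw : LinearIndependent ℂ w :=
      LinearIndependent.of_comp (Submodule.subtype _) ev_indep
    have := hw.finite
    exact not_finite ℕ
  have hlow : ∀ x : ℝ, (x : ℂ) ∈ spectrum ℂ A → -γ ≤ x := by
    intro x hx
    by_contra! hlt
    refine hx ?_
    have hc : 0 < -γ - x := by linarith
    refine ContinuousLinearMap.isUnit_of_forall_le_norm_inner_map _
      (c := ⟨-γ - x, hc.le⟩) hc fun f => ?_
    have h1 := re_inner_H₀_nonneg δ (u_nonneg δ hδ₁ hδ) H₀ hH₀ f
    have h2 : (inner ℂ (T₁ f) f).re ≤ ‖f‖ ^ 2 := by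
      calc (inner ℂ (T₁ f) f).re ≤ ‖inner ℂ (T₁ f) f‖ := Complex.re_le_norm _
        _ ≤ ‖T₁ f‖ * ‖f‖ := norm_inner_le_norm _ _
        _ ≤ ‖f‖ * ‖f‖ := by gcongr; exact norm_T₁_le T₁ hT₁ f
        _ = ‖f‖ ^ 2 := by ring
    have h3 : inner ℂ ((algebraMap ℂ (Lp ℂ 2 μI2 →L[ℂ] Lp ℂ 2 μI2) x - A) f) f
        = ((x * ‖f‖ ^ 2 : ℝ) : ℂ) - (inner ℂ (H₀ f) f - (γ : ℂ) * inner ℂ (T₁ f) f) := by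
      rw [Algebra.algebraMap_eq_smul_one]
      simp only [hA, sub_apply, smul_apply, inner_sub_left, inner_smul_left, Complex.conj_ofReal]
      have h6 : inner ℂ ((1 : Lp ℂ 2 μI2 →L[ℂ] Lp ℂ 2 μI2) f) f = ((‖f‖ : ℝ) : ℂ) ^ 2 :=
        inner_self_eq_norm_sq_to_K f
      rw [h6]
      push_cast
      rfl
    have h4 := (neg_le_abs _).trans (Complex.abs_re_le_norm
      (inner ℂ ((algebraMap ℂ (Lp ℂ 2 μI2 →L[ℂ] Lp ℂ 2 μI2) x - A) f) f))
    refine le_trans ?_ h4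
    rw [h3, Complex.sub_re, Complex.sub_re, Complex.ofReal_re, Complex.re_ofReal_mul]
    have h5 := mul_le_mul_of_nonneg_left h2 hγ
    change ‖f‖ ^ 2 * (-γ - x) ≤ _
    linarith
  refine ⟨IsLeast.csInf_eq ⟨hspec, fun x hx => hlow x hx⟩, hess, ?_⟩
  exact IsLeast.csInf_eq ⟨hess, fun x hx => hlow x hx.1⟩

end EfimovExample

end
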